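/- Fix a ∈ ℝ and let (Φ, W, Ψ, θ) be a solution of system (D) defined for all τ ∈ ℝ with Φ(τ) > 0 and θ(τ) ∈ (−π/2, π/2) for all τ. Suppose liminf_{τ→−∞} Φ(τ) < ∞ and limsup_{τ→−∞} ( Φ(τ) + |W(τ)| + |Ψ(τ)| ) = ∞. Then there exist a strictly decreasing sequence (τₙ*) with τₙ* → −∞ such that each τₙ* is a local maximum point of Φ with limsup_{n→∞} Φ(τₙ*) = ∞, a sequence (τₙ^{min}) with τₙ^{min} ∈ (τₙ*, τₙ₋₁*) and τₙ^{min} → −∞ satisfying Φ(τₙ^{min}) = min_{τ ∈ [τₙ*, τₙ₋₁*]} Φ(τ), W(τₙ^{min}) = 0 and Ψ(τₙ^{min}) ≥ 0 for every n, and an index n₀ ∈ ℕ such that Φ(τₙ₋₁^{min}) < Φ(τₙ^{min}) for all n > n₀. -/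

import Mathlib

open Filter Set

/-- The right-hand side of the `Ψ` equation in system (D). -/
noncomputable def dPsi (a Φ W Ψ θ : ℝ) : ℝ :=
  1 / Φ ^ 3 - 1 - (a - 1) * Real.cos θ ^ 2 -
    (((16 / 3) * Real.sin θ - (224 / 27) * Real.sin θ ^ 3) * Real.cos θ ^ ((17 : ℝ) / 3) * Φ
      + ((208 / 81) * Real.sin θ ^ 2 - 10 / 9) * Real.cos θ ^ ((34 : ℝ) / 9) * W
      + (2 / 3) * Real.sin θ * Real.cos θ ^ ((17 : ℝ) / 9) * Ψ)

/-- `(Φ, W, Ψ, θ)` is a solution of system (D) on all of `ℝ`. -/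
noncomputable def SolD (a : ℝ) (Φ W Ψ θ : ℝ → ℝ) : Prop :=
  ∀ τ : ℝ,
    HasDerivAt Φ (W τ) τ ∧
    HasDerivAt W (Ψ τ) τ ∧
    HasDerivAt Ψ (dPsi a (Φ τ) (W τ) (Ψ τ) (θ τ)) τ ∧
    HasDerivAt θ (Real.cos (θ τ) ^ ((26 : ℝ) / 9)) τ


lemma dec_of_deriv {F F' : ℝ → ℝ} {x y : ℝ} (hxy : x ≤ y)
    (h : ∀ s ∈ Icc x y, HasDerivAt F (F' s) s) (h' : ∀ s ∈ Icc x y, F' s ≤ 0) : F y ≤ F x := by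
  have : AntitoneOn F (Icc x y) := by
    apply antitoneOn_of_deriv_nonpos (convex_Icc x y)
    · exact fun s hs => (h s hs).continuousAt.continuousWithinAt
    · intro s hs
      exact (h s (interior_subset hs)).differentiableAt.differentiableWithinAt
    · intro s hs
      rw [(h s (interior_subset hs)).deriv]
      exact h' s (interior_subset hs)
  exact this (left_mem_Icc.2 hxy) (right_mem_Icc.2 hxy) hxy

lemma tri {q q1 q2 q3 : ℝ → ℝ} {x y : ℝ} (hxy : x ≤ y)
    (h0 : ∀ s ∈ Icc x y, HasDerivAt q (q1 s) s)
    (h1 : ∀ s ∈ Icc x y, HasDerivAt q1 (q2 s) s)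
    (h2 : ∀ s ∈ Icc x y, HasDerivAt q2 (q3 s) s)
    (h3 : ∀ s ∈ Icc x y, q3 s ≤ 0) :
    q y ≤ q x + q1 x * (y - x) + q2 x * (y - x) ^ 2 / 2 := by
  have a2 : ∀ s ∈ Icc x y, q2 s ≤ q2 x := fun s hs =>
    dec_of_deriv hs.1 (fun t ht => h2 t ⟨ht.1, ht.2.trans hs.2⟩) (fun t ht => h3 t ⟨ht.1, ht.2.trans hs.2⟩)
  have a1 : ∀ s ∈ Icc x y, q1 s ≤ q1 x + q2 x * (s - x) := by
    intro s hs
    have := dec_of_deriv (F := fun s => q1 s - q2 x * (s - x)) (F' := fun s => q2 s - q2 x) hs.1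
      (fun t ht => by
        have := (h1 t ⟨ht.1, ht.2.trans hs.2⟩).sub (((hasDerivAt_id t).sub_const x).const_mul (q2 x))
        refine HasDerivAt.congr_deriv this ?_
        simp)
      (fun t ht => by have := a2 t ⟨ht.1, ht.2.trans hs.2⟩; linarith)
    simp at this; linarith
  have := dec_of_deriv (F := fun s => q s - q1 x * (s - x) - q2 x * (s - x) ^ 2 / 2)
    (F' := fun s => q1 s - q1 x - q2 x * (s - x)) hxy
      (fun t ht => by
        have := ((h0 t ht).sub (((hasDerivAt_id t).sub_const x).const_mul (q1 x))).sub
          (((((hasDerivAt_id t).sub_const x).pow 2).const_mul (q2 x)).div_const 2)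
        refine HasDerivAt.congr_deriv this ?_
        simp; ring)
      (fun t ht => by have := a1 t ht; linarith)
  simp at this; linarith

/-- the transformed ODE -/
def Sol3 (a : ℝ) (f f1 f2 : ℝ → ℝ) : Prop :=
  ∀ s, 0 < f s ∧ HasDerivAt f (f1 s) s ∧ HasDerivAt f1 (f2 s) s ∧
    HasDerivAt f2 (s ^ 2 + a - 1 / (f s) ^ 3) s

lemma apriori {a : ℝ} {f f1 f2 : ℝ → ℝ} (H : Sol3 a f f1 f2) :
    ∃ S : ℝ, 1 ≤ S ∧ ∀ s, S ≤ s → f s ≤ s ^ 5 / 50 := by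
  set M := |f 0| + |f1 0| + |f2 0| + |a| with hM
  have hA := le_abs_self (f 0)
  have hB := le_abs_self (f1 0)
  have hD := le_abs_self (f2 0)
  have ha := le_abs_self a
  have hA' := abs_nonneg (f 0)
  have hB' := abs_nonneg (f1 0)
  have hD' := abs_nonneg (f2 0)
  have ha' := abs_nonneg a
  refine ⟨300 * M + 1, by linarith, fun s hs => ?_⟩
  have hs1 : 1 ≤ s := by linarith
  have key := tri (q := fun s => f s - s ^ 5 / 60 - a * s ^ 3 / 6)
    (q1 := fun s => f1 s - s ^ 4 / 12 - a * s ^ 2 / 2)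
    (q2 := fun s => f2 s - s ^ 3 / 3 - a * s)
    (q3 := fun s => - (1 / (f s) ^ 3)) (x := 0) (y := s) (by linarith)
    (fun t _ => by
      have := ((H t).2.1.sub (((hasDerivAt_id t).pow 5).div_const 60)).sub
        ((((hasDerivAt_id t).pow 3).const_mul a).div_const 6)
      refine HasDerivAt.congr_deriv this ?_
      simp; ring)
    (fun t _ => by
      have := ((H t).2.2.1.sub (((hasDerivAt_id t).pow 4).div_const 12)).sub
        ((((hasDerivAt_id t).pow 2).const_mul a).div_const 2)
      refine HasDerivAt.congr_deriv this ?_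
      simp; ring)
    (fun t _ => by
      have := ((H t).2.2.2.sub (((hasDerivAt_id t).pow 3).div_const 3)).sub
        (((hasDerivAt_id t)).const_mul a)
      refine HasDerivAt.congr_deriv this ?_
      simp; ring)
    (fun t _ => by
      have := (H t).1
      have : 0 < 1 / (f t) ^ 3 := by positivity
      linarith)
  norm_num at key
  have h2 : s ≤ s ^ 4 := by nlinarith [pow_le_pow_right₀ hs1 (show 1 ≤ 4 by norm_num)]
  have h3 : s ^ 2 ≤ s ^ 4 := pow_le_pow_right₀ hs1 (by norm_num)
  have h4 : s ^ 3 ≤ s ^ 4 := pow_le_pow_right₀ hs1 (by norm_num)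
  have h5 : 1 ≤ s ^ 4 := one_le_pow₀ hs1
  have e1 : f1 0 * s ≤ |f1 0| * s ^ 4 := by
    apply mul_le_mul hB h2 (by linarith) hB'
  have e2 : f2 0 * s ^ 2 ≤ |f2 0| * s ^ 4 := by
    apply mul_le_mul hD h3 (by positivity) hD'
  have e3 : a * s ^ 3 ≤ |a| * s ^ 4 := by
    apply mul_le_mul ha h4 (by positivity) ha'
  have e4 : f 0 ≤ |f 0| * s ^ 4 := by nlinarith
  have e5 : M * s ^ 4 * 300 ≤ s ^ 5 := by
    have : 300 * M ≤ s := by linarith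
    calc M * s ^ 4 * 300 = (300 * M) * s ^ 4 := by ring
      _ ≤ s * s ^ 4 := by gcongr
      _ = s ^ 5 := by ring
  have e6 : 0 ≤ |f2 0| * s ^ 4 := by positivity
  have e7 : 0 ≤ |a| * s ^ 4 := by positivity
  have : M * s ^ 4 = |f 0| * s ^ 4 + |f1 0| * s ^ 4 + |f2 0| * s ^ 4 + |a| * s ^ 4 := by rw [hM]; ring
  linarith

lemma second_test {f f1 : ℝ → ℝ} {f2 x : ℝ} (h0 : ∀ s, HasDerivAt f (f1 s) s)
    (h1 : HasDerivAt f1 f2 x) (hm : IsLocalMax f x) : f1 x = 0 ∧ f2 ≤ 0 := by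
  have hz : f1 x = 0 := hm.hasDerivAt_eq_zero (h0 x)
  refine ⟨hz, ?_⟩
  by_contra hc
  push Not at hc
  have hd : deriv f = f1 := funext fun s => (h0 s).deriv
  have hmin : IsLocalMin f x := isLocalMin_of_deriv_deriv_pos (by rw [hd, h1.deriv]; exact hc)
    (by rw [hd]; exact hz) (h0 x).continuousAt
  have : f =ᶠ[nhds x] fun _ => f x := by
    filter_upwards [hm, hmin] with y h1 h2
    exact le_antisymm h1 h2
  have h' := this.deriv
  rw [hd] at h'
  have h'' := h'.deriv_eq
  rw [h1.deriv] at h''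
  simp at h''
  linarith

lemma step1 {a : ℝ} {f f1 f2 : ℝ → ℝ} (H : Sol3 a f f1 f2)
    (hrec : ∃ C : ℝ, ∀ N, ∃ s, N ≤ s ∧ f s ≤ C) :
    ∃ S C : ℝ, 1 ≤ S ∧ ∀ s, S ≤ s → f s ≤ C := by
  obtain ⟨S0, hS0, hap⟩ := apriori H
  set S := S0 + 10 * |a| with hS
  have haa := abs_nonneg a
  have hS1 : 1 ≤ S := by linarith
  have har : ∀ s, S ≤ s → |a| * s⁻¹ ^ 2 ≤ 1 / 10 := by
    intro s hs
    have h1 : 1 ≤ s := by linarith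
    rw [inv_pow, ← div_eq_mul_inv, div_le_div_iff₀ (by positivity) (by norm_num)]
    nlinarith
  set J : ℝ → ℝ := fun s => (1 + a * s⁻¹ ^ 2) * f s + s⁻¹ ^ 2 / (2 * f s ^ 2)
    - s⁻¹ ^ 2 * f1 s * f2 s - s⁻¹ ^ 3 * f s * f2 s - (s⁻¹ ^ 3 / 2) * f1 s ^ 2
    - 3 * s⁻¹ ^ 4 * f s * f1 s - 6 * s⁻¹ ^ 5 * f s ^ 2 with hJ
  have hJd : ∀ s, S ≤ s → HasDerivAt J (- (s⁻¹ ^ 2 * f2 s ^ 2) - 3 / 2 * s⁻¹ ^ 4 * f1 s ^ 2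
      + 30 * s⁻¹ ^ 6 * f s ^ 2 - (s⁻¹ + 3 * a * s⁻¹ ^ 3) * f s) s := by
    intro s hs
    have h1 : 0 < s := by linarith
    obtain ⟨hp, d0, d1, d2⟩ := H s
    have dr : HasDerivAt (fun s : ℝ => s⁻¹) (-(s⁻¹ ^ 2)) s := by
      have := hasDerivAt_inv h1.ne'
      refine HasDerivAt.congr_deriv this ?_
      simp
    have := ((((((((((dr.pow 2).const_mul a).const_add 1).mul d0).add
      ((dr.pow 2).div ((d0.pow 2).const_mul 2) (by have := pow_pos hp 2; simp; exact hp.ne'))).sub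
      (((dr.pow 2).mul d1).mul d2)).sub (((dr.pow 3).mul d0).mul d2)).sub
      (((dr.pow 3).div_const 2).mul (d1.pow 2)))).sub
      ((((dr.pow 4).const_mul 3).mul d0).mul d1)).sub
      (((dr.pow 5).const_mul 6).mul (d0.pow 2))
    refine HasDerivAt.congr_deriv this ?_
    simp
    field_simp
    ring
  have hJle : ∀ s, S ≤ s → J s ≤ J S := by
    intro s hs
    refine dec_of_deriv hs (fun t ht => hJd t ht.1) (fun t ht => ?_)
    have h1 : 0 < t := by linarith [ht.1]
    have hp := (H t).1
    have hf := hap t (by linarith [ht.1])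
    have e1 : 30 * t⁻¹ ^ 6 * f t ^ 2 ≤ (3 / 5) * t⁻¹ * f t := by
      have : t⁻¹ ^ 6 * f t ≤ t⁻¹ / 50 := by
        calc t⁻¹ ^ 6 * f t ≤ t⁻¹ ^ 6 * (t ^ 5 / 50) := by gcongr
          _ = t⁻¹ / 50 := by field_simp
      nlinarith
    have e2 : -(3 * a * t⁻¹ ^ 3 * f t) ≤ 3 / 10 * t⁻¹ * f t := by
      have h2 := har t ht.1
      have h3 : -a * t⁻¹ ^ 2 ≤ 1 / 10 := by
        refine le_trans ?_ h2
        gcongr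
        exact neg_le_abs a
      have : 0 < t⁻¹ * f t := by positivity
      nlinarith
    have e3 : 0 ≤ t⁻¹ ^ 2 * f2 t ^ 2 := by positivity
    have e4 : 0 ≤ t⁻¹ ^ 4 * f1 t ^ 2 := by positivity
    have e5 : 0 < t⁻¹ * f t := by positivity
    linarith
  obtain ⟨C, hC⟩ := hrec
  refine ⟨S, max (max (f S) C) (2 * J S), hS1, fun s hs => ?_⟩
  by_contra hcon
  push Not at hcon
  simp only [max_lt_iff] at hcon
  obtain ⟨⟨c1, c2⟩, c3⟩ := hcon
  obtain ⟨y, hy, hyC⟩ := hC s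
  have hcont : Continuous f := continuous_iff_continuousAt.2 fun t => (H t).2.1.continuousAt
  obtain ⟨x, hx, hmax⟩ := isCompact_Icc.exists_isMaxOn (nonempty_Icc.2 (hs.trans hy)) hcont.continuousOn
  have hsx : f s ≤ f x := hmax ⟨hs, hy⟩
  have hx1 : S < x := lt_of_le_of_ne hx.1 (fun h => by rw [← h] at hsx; linarith)
  have hx2 : x < y := lt_of_le_of_ne hx.2 (fun h => by rw [h] at hsx; linarith)
  have hloc : IsLocalMax f x := hmax.isLocalMax (Icc_mem_nhds hx1 hx2)
  obtain ⟨z1, z2⟩ := second_test (fun t => (H t).2.1) (H x).2.2.1 hloc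
  have hJx := hJle x hx1.le
  have hp := (H x).1
  have h1 : 0 < x := by linarith
  have hf := hap x (by linarith)
  have : J x = (1 + a * x⁻¹ ^ 2) * f x + x⁻¹ ^ 2 / (2 * f x ^ 2)
     - x⁻¹ ^ 3 * f x * f2 x - 6 * x⁻¹ ^ 5 * f x ^ 2 := by
    simp [hJ, z1]
  have e1 : 6 * x⁻¹ ^ 5 * f x ^ 2 ≤ (3 / 25) * f x := by
    have : x⁻¹ ^ 5 * f x ≤ 1 / 50 := by
      calc x⁻¹ ^ 5 * f x ≤ x⁻¹ ^ 5 * (x ^ 5 / 50) := by gcongr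
        _ = 1 / 50 := by field_simp
    nlinarith
  have e2 : -(a * x⁻¹ ^ 2 * f x) ≤ 1 / 10 * f x := by
    have h2 := har x hx1.le
    have h3 : -a * x⁻¹ ^ 2 ≤ 1 / 10 := by
      refine le_trans ?_ h2
      gcongr
      exact neg_le_abs a
    nlinarith
  have e3 : 0 ≤ x⁻¹ ^ 3 * f x * (- f2 x) := by
    have : 0 ≤ - f2 x := by linarith
    positivity
  have e4 : 0 < x⁻¹ ^ 2 / (2 * f x ^ 2) := by positivity
  nlinarith

noncomputable def pp (s : ℝ) : ℝ := s ^ (-(1 / 3) : ℝ)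

lemma pp_pos {s : ℝ} (hs : 0 < s) : 0 < pp s := Real.rpow_pos_of_pos hs _

lemma pp_cube {s : ℝ} (hs : 0 < s) : s * pp s ^ 3 = 1 := by
  have : pp s ^ 3 = s⁻¹ := by
    unfold pp
    rw [← Real.rpow_natCast, ← Real.rpow_mul hs.le, ← Real.rpow_neg_one]
    norm_num
  rw [this]; field_simp

lemma pp_deriv {s : ℝ} (hs : 0 < s) : HasDerivAt pp (-(1 / 3) * pp s ^ 4) s := by
  have := Real.hasDerivAt_rpow_const (x := s) (p := (-(1 / 3) : ℝ)) (Or.inl hs.ne')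
  refine HasDerivAt.congr_deriv this ?_
  unfold pp
  congr 1
  rw [← Real.rpow_natCast, ← Real.rpow_mul hs.le]
  norm_num

lemma pp_le_one {s : ℝ} (hs : 1 ≤ s) : pp s ≤ 1 :=
  Real.rpow_le_one_of_one_le_of_nonpos hs (by norm_num)

lemma pp_anti {s t : ℝ} (hs : 0 < s) (h : s ≤ t) : pp t ≤ pp s :=
  Real.rpow_le_rpow_of_nonpos hs h (by norm_num)

lemma neg_escape {f f1 f2 f3 : ℝ → ℝ} {x : ℝ} (hp : ∀ s, 0 < f s)
    (h0 : ∀ s, HasDerivAt f (f1 s) s) (h1 : ∀ s, HasDerivAt f1 (f2 s) s)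
    (h2 : ∀ s, HasDerivAt f2 (f3 s) s) (h3 : ∀ s, x ≤ s → f3 s ≤ -1) : False := by
  have hA := le_abs_self (f x)
  have hB := le_abs_self (f1 x)
  have hD := le_abs_self (f2 x)
  have hA' := abs_nonneg (f x)
  have hB' := abs_nonneg (f1 x)
  have hD' := abs_nonneg (f2 x)
  set M := |f x| + |f1 x| + |f2 x| with hM
  set t := 6 * M + 7 with ht
  have ht1 : 1 ≤ t := by linarith
  have key := tri (q := fun s => f s + (s - x) ^ 3 / 6)
    (q1 := fun s => f1 s + (s - x) ^ 2 / 2)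
    (q2 := fun s => f2 s + (s - x))
    (q3 := fun s => f3 s + 1) (x := x) (y := x + t) (by linarith)
    (fun s _ => by
      have := (h0 s).add ((((hasDerivAt_id s).sub_const x).pow 3).div_const 6)
      refine HasDerivAt.congr_deriv this ?_
      simp; ring)
    (fun s _ => by
      have := (h1 s).add ((((hasDerivAt_id s).sub_const x).pow 2).div_const 2)
      refine HasDerivAt.congr_deriv this ?_
      simp)
    (fun s _ => by
      have := (h2 s).add ((hasDerivAt_id s).sub_const x)
      refine HasDerivAt.congr_deriv this ?_
      simp)
    (fun s hs => by have := h3 s hs.1; linarith)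
  simp at key
  have hpt := hp (x + t)
  have e1 : f1 x * t ≤ |f1 x| * t ^ 2 := by
    apply mul_le_mul hB (by nlinarith) (by linarith) hB'
  have e2 : f2 x * t ^ 2 ≤ |f2 x| * t ^ 2 := by gcongr
  have e3 : f x ≤ |f x| * t ^ 2 := by nlinarith
  have e4 : 0 ≤ |f2 x| * t ^ 2 := by positivity
  have e5 : M * t ^ 2 = |f x| * t ^ 2 + |f1 x| * t ^ 2 + |f2 x| * t ^ 2 := by rw [hM]; ring
  have e6 : t ^ 3 = 6 * (M * t ^ 2) + 7 * t ^ 2 := by rw [ht]; ring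
  nlinarith [sq_nonneg t]

set_option maxHeartbeats 2000000 in
lemma step2 {a : ℝ} {f f1 f2 : ℝ → ℝ} (H : Sol3 a f f1 f2)
    (hrec : ∃ C : ℝ, ∀ N, ∃ s, N ≤ s ∧ s * pp s * f s ≤ C) :
    ∃ S C c : ℝ, 1 ≤ S ∧ 0 < c ∧ |a| ≤ S ^ 2 / 2 ∧
      ∀ s, S ≤ s → c ≤ s * pp s * f s ∧ s * pp s * f s ≤ C := by
  have hsp : ∀ s, 1 ≤ s → 1 ≤ s * pp s := by
    intro s hs
    have h1 := pp_cube (show 0 < s by linarith)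
    have h2 := pp_le_one hs
    have h3 := pp_pos (show 0 < s by linarith)
    calc 1 = s * pp s * pp s ^ 2 := by rw [← h1]; ring
      _ ≤ s * pp s * 1 := by
        gcongr
        exact pow_le_one₀ h3.le h2
      _ = s * pp s := by ring
  obtain ⟨S0, C0, hS0, hC0⟩ := step1 H (by
    obtain ⟨C, hC⟩ := hrec
    refine ⟨C, fun N => ?_⟩
    obtain ⟨s, hs, hsC⟩ := hC (max N 1)
    refine ⟨s, (le_max_left _ _).trans hs, le_trans ?_ hsC⟩
    have := hsp s ((le_max_right _ _).trans hs)
    nlinarith [(H s).1])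
  have haa := abs_nonneg a
  set S := S0 + 2 * |a| with hS
  have hS1 : 1 ≤ S := by linarith
  have haS : ∀ s, S ≤ s → |a| ≤ s ^ 2 / 2 := by
    intro s hs; nlinarith
  have hfC : ∀ s, S ≤ s → f s ≤ C0 := fun s hs => hC0 s (by linarith)
  have hC0p : 0 < C0 := lt_of_lt_of_le (H S).1 (hfC S le_rfl)
  set K := 2 * |a| * C0 + 12 * C0 ^ 2 with hK
  have hK0 : 0 < K := by positivity
  set J : ℝ → ℝ := fun s => (s ^ 2 + a) * pp s ^ 4 * f s + pp s ^ 4 / (2 * f s ^ 2)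
    - pp s ^ 4 * f1 s * f2 s - 2 / 3 * pp s ^ 7 * f s * f2 s - 1 / 3 * pp s ^ 7 * f1 s ^ 2
    - 14 / 9 * pp s ^ 10 * f s * f1 s - 70 / 27 * pp s ^ 13 * f s ^ 2 with hJ
  have hJd : ∀ s, S ≤ s → HasDerivAt J (- (pp s ^ 4 * f2 s ^ 2) - 7 / 9 * pp s ^ 10 * f1 s ^ 2
      + 910 / 81 * pp s ^ 16 * f s ^ 2 - 2 * a * pp s ^ 7 * f s) s := by
    intro s hs
    have h1 : 0 < s := by linarith
    obtain ⟨hp, d0, d1, d2⟩ := H s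
    have dr := pp_deriv h1
    have hpp := pp_pos h1
    have hc := pp_cube h1
    have hse : s = (pp s ^ 3)⁻¹ := by field_simp; linarith
    have := (((((((((((hasDerivAt_id s).pow 2).add_const a).mul (dr.pow 4)).mul d0).add
      ((dr.pow 4).div ((d0.pow 2).const_mul 2)
        (by have := pow_pos hp 2; simp; exact hp.ne'))).sub
      (((dr.pow 4).mul d1).mul d2)).sub ((((dr.pow 7).const_mul (2 / 3)).mul d0).mul d2)).sub
      (((dr.pow 7).const_mul (1 / 3)).mul (d1.pow 2)))).sub
      ((((dr.pow 10).const_mul (14 / 9)).mul d0).mul d1)).sub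
      (((dr.pow 13).const_mul (70 / 27)).mul (d0.pow 2))
    refine HasDerivAt.congr_deriv this ?_
    simp
    generalize pp s = p at *
    generalize f s = F at *
    generalize f1 s = F1 at *
    generalize f2 s = F2 at *
    rw [hse]
    field_simp
    ring
  set B := J S + 3 / 4 * K * pp S ^ 4 with hB
  have hJle : ∀ s, S ≤ s → J s ≤ B := by
    intro s hs
    have key := dec_of_deriv (F := fun s => J s + 3 / 4 * K * pp s ^ 4)
      (F' := fun s => - (pp s ^ 4 * f2 s ^ 2) - 7 / 9 * pp s ^ 10 * f1 s ^ 2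
      + 910 / 81 * pp s ^ 16 * f s ^ 2 - 2 * a * pp s ^ 7 * f s - K * pp s ^ 7) hs
      (fun t ht => ((hJd t ht.1).add
        (((pp_deriv (show 0 < t by linarith [ht.1])).pow 4).const_mul (3 / 4 * K))).congr_deriv
        (by norm_num; ring)) (fun t ht => ?_)
    · have : 0 < pp s := pp_pos (by linarith)
      have : 0 < 3 / 4 * K * pp s ^ 4 := by positivity
      have key' : J s + 3 / 4 * K * pp s ^ 4 ≤ J S + 3 / 4 * K * pp S ^ 4 := key
      linarith
    · have h1 : 1 ≤ t := by linarith [ht.1]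
      have hp := (H t).1
      have hf := hfC t ht.1
      have q1 := pp_le_one h1
      have q0 := pp_pos (show 0 < t by linarith)
      have e1 : pp t ^ 16 * f t ^ 2 ≤ pp t ^ 7 * C0 ^ 2 := by
        have : pp t ^ 16 ≤ pp t ^ 7 := pow_le_pow_of_le_one q0.le q1 (by norm_num)
        gcongr
      have e2 : -(a * pp t ^ 7 * f t) ≤ |a| * pp t ^ 7 * C0 := by
        calc -(a * pp t ^ 7 * f t) = (-a) * pp t ^ 7 * f t := by ring
          _ ≤ |a| * pp t ^ 7 * f t := by gcongr; exact neg_le_abs a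
          _ ≤ _ := by gcongr
      have e3 : 0 ≤ pp t ^ 4 * f2 t ^ 2 := by positivity
      have e4 : 0 ≤ pp t ^ 10 * f1 t ^ 2 := by positivity
      have e5 : K * pp t ^ 7 = 2 * (|a| * pp t ^ 7 * C0) + 12 * (pp t ^ 7 * C0 ^ 2) := by
        rw [hK]; ring
      have e6 : 0 ≤ pp t ^ 7 * C0 ^ 2 := by positivity
      linarith
  set u : ℝ → ℝ := fun s => s * pp s * f s with hu
  have hud : ∀ s, 0 < s → HasDerivAt u (2 / 3 * pp s * f s + s * pp s * f1 s) s := by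
    intro s hs
    have := ((hasDerivAt_id s).mul (pp_deriv hs)).mul (H s).2.1
    refine HasDerivAt.congr_deriv this ?_
    have hc := pp_cube hs
    simp only [id_eq, Pi.mul_apply]
    linear_combination (-(1 / 3) * pp s * f s) * hc
  have hupos : ∀ s, 0 < s → 0 < u s := fun s hs => by
    have := (H s).1
    have := pp_pos hs
    simp only [hu]; positivity
  set B' := max 1 (B + 2 * C0 ^ 2) with hB'
  have hB'1 : 1 ≤ B' := le_max_left _ _
  have hcrit : ∀ x, S ≤ x → 2 / 3 * pp x * f x + x * pp x * f1 x = 0 →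
      u x ≤ 2 * B' ∧ 1 / (2 * u x ^ 2) ≤ B' := by
    intro x hx hz
    have h1 : 1 ≤ x := by linarith
    have h0 : 0 < x := by linarith
    have q0 := pp_pos h0
    have q1 := pp_le_one h1
    have hc := pp_cube h0
    have hp := (H x).1
    have hup := hupos x h0
    have hf1 : f1 x = - (2 / 3) * pp x ^ 3 * f x := by
      have : pp x * (f1 x + (2 / 3) * pp x ^ 3 * f x) = 0 := by
        linear_combination (pp x ^ 3) * hz - pp x * f1 x * hc
      rcases mul_eq_zero.1 this with h | h
      · linarith
      · linarith
    have hJx : J x = u x + a * pp x ^ 6 * u x + 1 / (2 * u x ^ 2) - 46 / 27 * pp x ^ 13 * f x ^ 2 := by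
      simp only [hJ, hu, hf1]
      have hse : x = (pp x ^ 3)⁻¹ := by field_simp; linarith
      generalize pp x = p at *
      generalize f x = F at *
      generalize f2 x = F2 at *
      rw [hse]
      field_simp
      ring
    have e1 : pp x ^ 13 * f x ^ 2 ≤ C0 ^ 2 := by
      have : pp x ^ 13 ≤ 1 := pow_le_one₀ q0.le q1
      have := hfC x hx
      calc pp x ^ 13 * f x ^ 2 ≤ 1 * C0 ^ 2 := by gcongr
        _ = _ := by ring
    have e2 : -(a * pp x ^ 6 * u x) ≤ 1 / 2 * u x := by
      have : -a * pp x ^ 6 ≤ 1 / 2 := by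
        calc -a * pp x ^ 6 ≤ |a| * pp x ^ 6 := by gcongr; exact neg_le_abs a
          _ ≤ x ^ 2 / 2 * pp x ^ 6 := by gcongr; exact haS x hx
          _ = (x * pp x ^ 3) ^ 2 / 2 := by ring
          _ = 1 / 2 := by rw [hc]; norm_num
      nlinarith
    have e3 := hJle x hx
    have e4 : B + 2 * C0 ^ 2 ≤ B' := le_max_right _ _
    have e5 : 0 < 1 / (2 * u x ^ 2) := by positivity
    have e6 : 0 < C0 ^ 2 := by positivity
    constructor <;> linarith
  have hcont : ∀ y, ContinuousOn u (Icc S y) := fun y t ht =>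
    (hud t (by linarith [ht.1])).continuousAt.continuousWithinAt
  obtain ⟨C, hC⟩ := hrec
  set c := min (min (u S) (1 / 2)) (1 / (2 * B')) with hc
  have hc0 : 0 < c := by
    have := hupos S (by linarith)
    refine lt_min (lt_min this (by norm_num)) (by positivity)
  refine ⟨S, max (max (u S) C) (2 * B'), c, hS1, hc0, haS S le_rfl, fun s hs => ⟨?_, ?_⟩⟩
  · by_contra hcon
    push Not at hcon
    change u s < c at hcon
    have hcS : c ≤ u S := (min_le_left _ _).trans (min_le_left _ _)
    have hc2 : c ≤ 1 / 2 := (min_le_left _ _).trans (min_le_right _ _)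
    have hcB : c ≤ 1 / (2 * B') := min_le_right _ _
    by_cases hex : ∃ y, s ≤ y ∧ c ≤ u y
    · obtain ⟨y, hy, hyc⟩ := hex
      obtain ⟨x, hx, hmin⟩ := isCompact_Icc.exists_isMinOn (nonempty_Icc.2 (hs.trans hy)) (hcont y)
      have hsx : u x ≤ u s := hmin ⟨hs, hy⟩
      have hx1 : S < x := lt_of_le_of_ne hx.1 (fun h => by rw [← h] at hsx; linarith)
      have hx2 : x < y := lt_of_le_of_ne hx.2 (fun h => by rw [h] at hsx; linarith)
      have hz := (hmin.isLocalMin (Icc_mem_nhds hx1 hx2)).hasDerivAt_eq_zero (hud x (by linarith))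
      have h2 := (hcrit x hx1.le hz).2
      have hup := hupos x (by linarith)
      rw [div_le_iff₀ (by positivity)] at h2
      rw [le_div_iff₀ (by positivity)] at hcB
      have : u x ^ 2 < c := by nlinarith
      nlinarith
    · push Not at hex
      refine neg_escape (x := s) (fun t => (H t).1) (fun t => (H t).2.1) (fun t => (H t).2.2.1)
        (fun t => (H t).2.2.2) (fun t ht => ?_)
      have hut := hex t ht
      have h0 : 0 < t := by linarith
      have h1 : 1 ≤ t := by linarith
      have hup := hupos t h0
      have hcc := pp_cube h0
      have hfp := (H t).1
      have hu3 : u t ^ 3 = t ^ 2 * f t ^ 3 := by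
        simp only [hu]
        linear_combination (t ^ 2 * f t ^ 3) * hcc
      have hu4 : u t ^ 3 ≤ (1 / 2) ^ 3 := by
        gcongr
        linarith
      have : 8 * t ^ 2 ≤ 1 / f t ^ 3 := by
        rw [le_div_iff₀ (by positivity)]
        nlinarith
      have := haS t (hs.trans ht)
      have := le_abs_self a
      nlinarith
  · by_contra hcon
    push Not at hcon
    simp only [max_lt_iff] at hcon
    change (u S < u s ∧ C < u s) ∧ 2 * B' < u s at hcon
    obtain ⟨⟨c1, c2⟩, c3⟩ := hcon
    obtain ⟨y, hy, hyC⟩ := hC s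
    change u y ≤ C at hyC
    obtain ⟨x, hx, hmax⟩ := isCompact_Icc.exists_isMaxOn (nonempty_Icc.2 (hs.trans hy)) (hcont y)
    have hsx : u s ≤ u x := hmax ⟨hs, hy⟩
    have hx1 : S < x := lt_of_le_of_ne hx.1 (fun h => by rw [← h] at hsx; linarith)
    have hx2 : x < y := lt_of_le_of_ne hx.2 (fun h => by rw [h] at hsx; linarith)
    have hz := (hmax.isLocalMax (Icc_mem_nhds hx1 hx2)).hasDerivAt_eq_zero (hud x (by linarith))
    have := (hcrit x hx1.le hz).1
    linarith

lemma landau {f f1 f2 f3 : ℝ → ℝ} {x h K A : ℝ} (hh : 0 < h)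
    (h0 : ∀ s, HasDerivAt f (f1 s) s) (h1 : ∀ s, HasDerivAt f1 (f2 s) s)
    (h2 : ∀ s, HasDerivAt f2 (f3 s) s) (h3 : ∀ s ∈ Icc x (x + 2 * h), |f3 s| ≤ K)
    (hf : ∀ s ∈ Icc x (x + 2 * h), 0 ≤ f s ∧ f s ≤ A) :
    |f1 x| * h ≤ 4 * A + K * h ^ 3 ∧ |f2 x| * h ^ 2 ≤ 4 * A + 2 * K * h ^ 3 := by
  have up : ∀ t, 0 ≤ t → t ≤ 2 * h →
      f (x + t) ≤ f x + f1 x * t + f2 x * t ^ 2 / 2 + K * t ^ 3 / 6 := by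
    intro t ht0 ht
    have key := tri (q := fun s => f s - K * (s - x) ^ 3 / 6)
      (q1 := fun s => f1 s - K * (s - x) ^ 2 / 2)
      (q2 := fun s => f2 s - K * (s - x))
      (q3 := fun s => f3 s - K) (x := x) (y := x + t) (by linarith)
      (fun s _ => by
        have := (h0 s).sub (((((hasDerivAt_id s).sub_const x).pow 3).const_mul K).div_const 6)
        refine HasDerivAt.congr_deriv this ?_
        simp; ring)
      (fun s _ => by
        have := (h1 s).sub (((((hasDerivAt_id s).sub_const x).pow 2).const_mul K).div_const 2)
        refine HasDerivAt.congr_deriv this ?_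
        simp; ring)
      (fun s _ => by
        have := (h2 s).sub (((hasDerivAt_id s).sub_const x).const_mul K)
        refine HasDerivAt.congr_deriv this ?_
        simp)
      (fun s hs => by
        have := (abs_le.1 (h3 s ⟨hs.1, by linarith [hs.2]⟩)).2
        linarith)
    simp at key
    linarith
  have lo : ∀ t, 0 ≤ t → t ≤ 2 * h →
      f x + f1 x * t + f2 x * t ^ 2 / 2 - K * t ^ 3 / 6 ≤ f (x + t) := by
    intro t ht0 ht
    have key := tri (q := fun s => - f s - K * (s - x) ^ 3 / 6)
      (q1 := fun s => - f1 s - K * (s - x) ^ 2 / 2)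
      (q2 := fun s => - f2 s - K * (s - x))
      (q3 := fun s => - f3 s - K) (x := x) (y := x + t) (by linarith)
      (fun s _ => by
        have := (h0 s).neg.sub (((((hasDerivAt_id s).sub_const x).pow 3).const_mul K).div_const 6)
        refine HasDerivAt.congr_deriv this ?_
        simp; ring)
      (fun s _ => by
        have := (h1 s).neg.sub (((((hasDerivAt_id s).sub_const x).pow 2).const_mul K).div_const 2)
        refine HasDerivAt.congr_deriv this ?_
        simp; ring)
      (fun s _ => by
        have := (h2 s).neg.sub (((hasDerivAt_id s).sub_const x).const_mul K)
        refine HasDerivAt.congr_deriv this ?_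
        simp)
      (fun s hs => by
        have := (abs_le.1 (h3 s ⟨hs.1, by linarith [hs.2]⟩)).1
        linarith)
    simp at key
    linarith
  have u1 := up h hh.le (by linarith)
  have u2 := up (2 * h) (by linarith) le_rfl
  have l1 := lo h hh.le (by linarith)
  have l2 := lo (2 * h) (by linarith) le_rfl
  have b0 := hf x ⟨le_rfl, by linarith⟩
  have b1 := hf (x + h) ⟨by linarith, by linarith⟩
  have b2 := hf (x + 2 * h) ⟨by linarith, by linarith⟩
  have hK : 0 ≤ K := le_trans (abs_nonneg _) (h3 x ⟨le_rfl, by linarith⟩)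
  have hKh : 0 ≤ K * h ^ 3 := by positivity
  have a1 : |f1 x| * h = |f1 x * h| := by rw [abs_mul, abs_of_pos hh]
  have a2 : |f2 x| * h ^ 2 = |f2 x * h ^ 2| := by rw [abs_mul, abs_of_pos (pow_pos hh 2)]
  rw [a1, a2]
  constructor <;> rw [abs_le] <;> constructor <;> nlinarith

noncomputable def ww (s : ℝ) : ℝ := s ^ (-(1 / 9) : ℝ)

lemma ww_pos {s : ℝ} (hs : 0 < s) : 0 < ww s := Real.rpow_pos_of_pos hs _

lemma pp_eq_ww {s : ℝ} (hs : 0 < s) : pp s = ww s ^ 3 := by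
  unfold pp ww
  rw [← Real.rpow_natCast, ← Real.rpow_mul hs.le]
  norm_num

lemma ww_nine {s : ℝ} (hs : 0 < s) : s * ww s ^ 9 = 1 := by
  rw [← pp_cube hs, pp_eq_ww hs]; ring

lemma ww_le_one {s : ℝ} (hs : 1 ≤ s) : ww s ≤ 1 :=
  Real.rpow_le_one_of_one_le_of_nonpos hs (by norm_num)

lemma step3 {a : ℝ} {f f1 f2 : ℝ → ℝ} (H : Sol3 a f f1 f2)
    (hrec : ∃ C : ℝ, ∀ N, ∃ s, N ≤ s ∧ s * pp s * f s ≤ C) :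
    ∃ S C : ℝ, 1 ≤ S ∧ 0 < C ∧
      ∀ s, S ≤ s → s * pp s * f s ≤ C ∧ |f1 s| * ww s ^ 2 ≤ C ∧ |f2 s| * ww s ^ 10 ≤ C := by
  obtain ⟨S, C, c, hS, hc, haS, hb⟩ := step2 H hrec
  set K := 9 * (2 + 1 / c ^ 3) with hK
  have hK0 : 0 < K := by positivity
  have hC0 : 0 < C := by have := hb S le_rfl; linarith [this.1, this.2]
  refine ⟨S, 4 * C + 2 * K, hS, by positivity, fun s hs => ?_⟩
  have h1 : 1 ≤ s := by linarith
  have h0 : 0 < s := by linarith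
  have w0 := ww_pos h0
  have w1 := ww_le_one h1
  have w9 := ww_nine h0
  have hh1 : ww s ^ 8 ≤ 1 := pow_le_one₀ w0.le w1
  have key := landau (x := s) (h := ww s ^ 8) (K := K * s ^ 2) (A := C * ww s ^ 6) (by positivity)
    (fun t => (H t).2.1) (fun t => (H t).2.2.1) (fun t => (H t).2.2.2)
    (fun t ht => by
      have ht0 : 0 < t := by linarith [ht.1]
      have ht3 : t ≤ 3 * s := by linarith [ht.2]
      have hfp := (H t).1
      have hp := pp_pos ht0
      have hcc := pp_cube ht0
      have hu := (hb t (hs.trans ht.1)).1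
      have hu3 : (t * pp t * f t) ^ 3 = t ^ 2 * f t ^ 3 := by
        linear_combination (t ^ 2 * f t ^ 3) * hcc
      have hu4 : c ^ 3 ≤ t ^ 2 * f t ^ 3 := by
        rw [← hu3]; gcongr
      have hf3 : 1 / f t ^ 3 ≤ t ^ 2 * (1 / c ^ 3) := by
        rw [mul_one_div, div_le_div_iff₀ (by positivity) (by positivity)]
        linarith
      have hf4 : 0 < 1 / f t ^ 3 := by positivity
      have hat : |a| ≤ t ^ 2 := by nlinarith [ht.1]
      have : t ^ 2 ≤ 9 * s ^ 2 := by nlinarith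
      have hKt : t ^ 2 * (2 + 1 / c ^ 3) ≤ K * s ^ 2 := by
        calc t ^ 2 * (2 + 1 / c ^ 3) ≤ 9 * s ^ 2 * (2 + 1 / c ^ 3) := by gcongr
          _ = _ := by rw [hK]; ring
      have := abs_le.1 hat
      rw [abs_le]
      constructor <;> nlinarith)
    (fun t ht => by
      have ht0 : 0 < t := by linarith [ht.1]
      have hfp := (H t).1
      refine ⟨hfp.le, ?_⟩
      have hp := pp_pos ht0
      have hcc := pp_cube ht0
      have hu := (hb t (hs.trans ht.1)).2
      have : f t = (t * pp t * f t) * pp t ^ 2 := by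
        linear_combination (- f t) * hcc
      rw [this]
      have h2 := pp_anti h0 ht.1
      calc (t * pp t * f t) * pp t ^ 2 ≤ C * pp s ^ 2 := by gcongr
        _ = C * ww s ^ 6 := by rw [pp_eq_ww h0]; ring)
  have e : K * s ^ 2 * (ww s ^ 8) ^ 3 = K * ww s ^ 6 := by
    linear_combination (K * ww s ^ 6 * (s * ww s ^ 9 + 1)) * w9
  rw [mul_assoc 2, e] at key
  refine ⟨by linarith [(hb s hs).2], ?_, ?_⟩
  · have := key.1
    refine le_of_mul_le_mul_right ?_ (pow_pos w0 6)
    nlinarith [pow_pos w0 6]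
  · have := key.2
    refine le_of_mul_le_mul_right ?_ (pow_pos w0 6)
    nlinarith [pow_pos w0 6]

noncomputable def GG (y : ℝ) : ℝ := ∫ t in (0:ℝ)..y, (1 + t ^ 2) ^ (4 / 9 : ℝ)

lemma GG_deriv (y : ℝ) : HasDerivAt GG ((1 + y ^ 2) ^ (4 / 9 : ℝ)) y := by
  have hc : Continuous fun t : ℝ => (1 + t ^ 2) ^ (4 / 9 : ℝ) :=
    Continuous.rpow_const (by fun_prop) (fun t => Or.inl (by positivity))
  exact intervalIntegral.integral_hasDerivAt_right (hc.intervalIntegrable _ _)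
    (hc.stronglyMeasurableAtFilter _ _) hc.continuousAt

lemma GG_strictMono : StrictMono GG := by
  apply strictMono_of_deriv_pos
  intro y
  rw [(GG_deriv y).deriv]
  positivity

lemma no_solution (a : ℝ) (Φ W Ψ θ : ℝ → ℝ)
    (hsol : SolD a Φ W Ψ θ)
    (hΦpos : ∀ τ : ℝ, 0 < Φ τ)
    (hθ : ∀ τ : ℝ, θ τ ∈ Set.Ioo (-(Real.pi / 2)) (Real.pi / 2))
    (hliminf : Filter.liminf (fun τ : ℝ => ((Φ τ : ℝ) : EReal)) atBot < ⊤)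
    (hlimsup : Filter.limsup (fun τ : ℝ => ((Φ τ + |W τ| + |Ψ τ| : ℝ) : EReal)) atBot = ⊤) :
    False := by
  have hcos : ∀ τ, 0 < Real.cos (θ τ) := fun τ => Real.cos_pos_of_mem_Ioo (hθ τ)
  set v : ℝ → ℝ := fun τ => Real.cos (θ τ) ^ (1 / 9 : ℝ) with hv
  have v0 : ∀ τ, 0 < v τ := fun τ => Real.rpow_pos_of_pos (hcos τ) _
  have vpow : ∀ τ (n : ℕ), Real.cos (θ τ) ^ ((n : ℝ) / 9) = v τ ^ n := by
    intro τ n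
    simp only [hv]
    rw [← Real.rpow_natCast, ← Real.rpow_mul (hcos τ).le]
    congr 1; ring
  have v9 : ∀ τ, Real.cos (θ τ) = v τ ^ 9 := by
    intro τ
    rw [← vpow]; norm_num
  have vs : ∀ τ, Real.sin (θ τ) ^ 2 + v τ ^ 18 = 1 := by
    intro τ
    rw [← Real.sin_sq_add_cos_sq (θ τ), v9]; ring
  have dθ : ∀ τ, HasDerivAt θ (v τ ^ 26) τ := by
    intro τ
    have := (hsol τ).2.2.2
    rw [← vpow]; exact_mod_cast this
  have dc : ∀ τ, HasDerivAt (fun τ => Real.cos (θ τ)) (- Real.sin (θ τ) * v τ ^ 26) τ :=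
    fun τ => (dθ τ).cos
  have ds : ∀ τ, HasDerivAt (fun τ => Real.sin (θ τ)) (v τ ^ 35) τ := by
    intro τ
    refine (dθ τ).sin.congr_deriv ?_
    rw [v9]; ring
  have dv : ∀ τ, HasDerivAt v (-(1 / 9) * Real.sin (θ τ) * v τ ^ 18) τ := by
    intro τ
    have := (dc τ).rpow_const (p := (1 / 9 : ℝ)) (Or.inl (hcos τ).ne')
    refine this.congr_deriv ?_
    have e : Real.cos (θ τ) ^ ((1 / 9 : ℝ) - 1) = v τ / v τ ^ 9 := by
      rw [Real.rpow_sub (hcos τ), Real.rpow_one, ← v9]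
    rw [e]
    have := v0 τ
    field_simp
  have dtan : ∀ τ, HasDerivAt (fun τ => Real.tan (θ τ)) (v τ ^ 8) τ := by
    intro τ
    have := (Real.hasDerivAt_tan (hcos τ).ne').comp τ (dθ τ)
    refine this.congr_deriv ?_
    rw [v9]
    have := v0 τ
    field_simp
  have htan1 : ∀ τ, (1 + Real.tan (θ τ) ^ 2) * v τ ^ 18 = 1 := by
    intro τ
    rw [Real.tan_eq_sin_div_cos, v9]
    have := v0 τ
    have := vs τ
    field_simp
    linarith
  have htan : ∀ τ, (1 + Real.tan (θ τ) ^ 2) ^ (4 / 9 : ℝ) * v τ ^ 8 = 1 := by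
    intro τ
    have e : v τ ^ 8 = (v τ ^ 18) ^ (4 / 9 : ℝ) := by
      rw [← Real.rpow_natCast, ← Real.rpow_natCast, ← Real.rpow_mul (v0 τ).le]
      norm_num
    rw [e, ← Real.mul_rpow (by positivity) (by have := v0 τ; positivity), htan1]
    simp
  have dG : ∀ τ, HasDerivAt (fun τ => GG (Real.tan (θ τ)) - τ) 0 τ := by
    intro τ
    have := ((GG_deriv (Real.tan (θ τ))).comp τ (dtan τ)).sub (hasDerivAt_id τ)
    refine this.congr_deriv ?_
    rw [htan]; norm_num
  set k := GG (Real.tan (θ 0)) with hk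
  have hG : ∀ τ, GG (Real.tan (θ τ)) = τ + k := by
    intro τ
    have := is_const_of_deriv_eq_zero (fun τ => (dG τ).differentiableAt) (fun τ => (dG τ).deriv) τ 0
    simp only [sub_zero] at this
    linarith
  set T : ℝ → ℝ := fun s => GG (-s) - k with hT
  have tanT : ∀ s, Real.tan (θ (T s)) = -s := by
    intro s
    apply GG_strictMono.injective
    rw [hG]; simp [hT]
  have Tinv : ∀ τ, T (- Real.tan (θ τ)) = τ := by
    intro τ
    simp [hT, hG]
  have Tanti : StrictAnti T := by
    intro s t hst
    have := GG_strictMono (neg_lt_neg hst)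
    simp only [hT]; linarith
  have dT : ∀ s, HasDerivAt T (-(1 / v (T s) ^ 8)) s := by
    intro s
    have := ((GG_deriv (-s)).comp s (hasDerivAt_neg s)).sub_const k
    refine this.congr_deriv ?_
    have h := htan (T s)
    rw [tanT] at h
    have := v0 (T s)
    have : (1 + (-s) ^ 2) ^ (4 / 9 : ℝ) = 1 / v (T s) ^ 8 := by
      rw [eq_div_iff (by positivity)]; exact h
    rw [this]; ring
  -- transformed functions
  set h0 : ℝ → ℝ := fun τ => v τ ^ 6 * Φ τ with hh0
  set h1 : ℝ → ℝ := fun τ => (W τ - 2 / 3 * Real.sin (θ τ) * v τ ^ 17 * Φ τ) / v τ ^ 2 with hh1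
  set h2 : ℝ → ℝ := fun τ => (Ψ τ - 4 / 9 * Real.sin (θ τ) * v τ ^ 17 * W τ
    + (16 / 9 * Real.sin (θ τ) ^ 2 - 2 / 3) * v τ ^ 34 * Φ τ) / v τ ^ 10 with hh2
  have d0 : ∀ τ, HasDerivAt h0 (v τ ^ 8 * h1 τ) τ := by
    intro τ
    have := ((dv τ).pow 6).mul (hsol τ).1
    refine this.congr_deriv ?_
    have := v0 τ
    simp only [hh1, Pi.pow_apply]
    norm_num
    field_simp
    ring
  have d1 : ∀ τ, HasDerivAt h1 (v τ ^ 8 * h2 τ) τ := by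
    intro τ
    have hp := v0 τ
    have := ((hsol τ).2.1.sub ((((ds τ).const_mul (2 / 3)).mul ((dv τ).pow 17)).mul (hsol τ).1)).div
      ((dv τ).pow 2) (by simp; exact hp.ne')
    refine this.congr_deriv ?_
    simp only [hh2, Pi.pow_apply, Pi.mul_apply, Pi.sub_apply]
    norm_num
    have hs := vs τ
    generalize v τ = x at *
    generalize Real.sin (θ τ) = y at *
    have hx : x ^ 18 = 1 - y ^ 2 := by linarith
    have hx35 : x ^ 35 = x ^ 17 * (1 - y ^ 2) := by rw [← hx]; ring
    rw [hx35]
    field_simp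
    ring
  have d2 : ∀ τ, HasDerivAt h2 (v τ ^ 8 * (1 / h0 τ ^ 3 - a - Real.tan (θ τ) ^ 2)) τ := by
    intro τ
    have hp := v0 τ
    have hΦ := hΦpos τ
    have := (((hsol τ).2.2.1.sub ((((ds τ).const_mul (4 / 9)).mul ((dv τ).pow 17)).mul (hsol τ).2.1)).add
      ((((((ds τ).pow 2).const_mul (16 / 9)).sub_const (2 / 3)).mul ((dv τ).pow 34)).mul (hsol τ).1)).div
      ((dv τ).pow 10) (by simp; exact hp.ne')
    refine this.congr_deriv ?_
    have p51 : Real.cos (θ τ) ^ ((17 : ℝ) / 3) = v τ ^ 51 := by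
      rw [← vpow]; norm_num
    have p34 : Real.cos (θ τ) ^ ((34 : ℝ) / 9) = v τ ^ 34 := by
      rw [← vpow]; norm_num
    have p17 : Real.cos (θ τ) ^ ((17 : ℝ) / 9) = v τ ^ 17 := by
      rw [← vpow]; norm_num
    simp only [hh0, Pi.pow_apply, Pi.mul_apply, Pi.sub_apply, Pi.add_apply, dPsi, p51, p34, p17]
    simp only [Real.tan_eq_sin_div_cos, v9, Nat.cast_ofNat, Nat.reduceSub]
    have hs := vs τ
    generalize v τ = x at *
    generalize Real.sin (θ τ) = y at *
    generalize Φ τ = P at *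
    generalize W τ = Q at *
    generalize Ψ τ = R at *
    have hx : x ^ 18 = 1 - y ^ 2 := by linarith
    have hx35 : x ^ 35 = x ^ 17 * (1 - y ^ 2) := by rw [← hx]; ring
    have hx9 : (x ^ 9) ^ 2 = (1 - y ^ 2) := by rw [← hx]; ring
    have e1 : 1 / P ^ 3 - 1 - (a - 1) * (x ^ 9) ^ 2 = 1 / P ^ 3 - a * x ^ 18 - y ^ 2 := by
      linear_combination hs
    rw [e1, hx35]
    field_simp
    ring_nf
  have H : Sol3 a (fun s => h0 (T s)) (fun s => - h1 (T s)) (fun s => h2 (T s)) := by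
    intro s
    have hp := v0 (T s)
    refine ⟨by have := hΦpos (T s); simp only [hh0]; positivity, ?_, ?_, ?_⟩
    · refine ((d0 (T s)).comp s (dT s)).congr_deriv ?_
      field_simp
    · refine ((d1 (T s)).comp s (dT s)).neg.congr_deriv ?_
      field_simp
    · refine ((d2 (T s)).comp s (dT s)).congr_deriv ?_
      rw [tanT]
      field_simp
      ring
  -- comparison of v and ww
  have cmp : ∀ s, 1 ≤ s → v (T s) ≤ ww s ∧ ww s ^ 6 ≤ 2 * v (T s) ^ 6 := by
    intro s hs
    have hp := v0 (T s)
    have hs0 : 0 < s := by linarith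
    have w0 := ww_pos hs0
    have w9 := ww_nine hs0
    have h := htan1 (T s)
    rw [tanT] at h
    have w18 : s ^ 2 * ww s ^ 18 = 1 := by
      linear_combination (s * ww s ^ 9 + 1) * w9
    constructor
    · refine le_of_pow_le_pow_left₀ (n := 18) (by norm_num) w0.le ?_
      have : s ^ 2 * v (T s) ^ 18 ≤ s ^ 2 * ww s ^ 18 := by
        have := pow_pos hp 18
        nlinarith
      exact le_of_mul_le_mul_left this (by positivity)
    · refine le_of_pow_le_pow_left₀ (n := 3) (by norm_num) (by positivity) ?_
      have e1 : (ww s ^ 6) ^ 3 = ww s ^ 18 := by ring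
      have e2 : (2 * v (T s) ^ 6) ^ 3 = 8 * v (T s) ^ 18 := by ring
      rw [e1, e2]
      have : s ^ 2 * ww s ^ 18 ≤ s ^ 2 * (8 * v (T s) ^ 18) := by
        have := pow_pos hp 18
        nlinarith
      exact le_of_mul_le_mul_left this (by positivity)
  have hspp : ∀ s, 0 < s → s * pp s * ww s ^ 6 = 1 := by
    intro s hs
    rw [pp_eq_ww hs]
    linear_combination ww_nine hs
  have hTev : ∀ N, ∀ τ, τ ≤ T N → N ≤ - Real.tan (θ τ) := by
    intro N τ h
    rw [← Tinv τ] at h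
    exact Tanti.le_iff_ge.1 h
  obtain ⟨C, hC1, hC2⟩ := EReal.lt_iff_exists_real_btwn.1 hliminf
  have hfr := Filter.frequently_lt_of_liminf_lt (by isBoundedDefault) hC1
  obtain ⟨S, K, hS, hK, hb⟩ := step3 H ⟨C, fun N => by
    obtain ⟨τ, hτ1, hτ2⟩ := (hfr.and_eventually (eventually_le_atBot (T (max N 1)))).exists
    have hN := hTev _ _ hτ2
    refine ⟨- Real.tan (θ τ), (le_max_left _ _).trans hN, ?_⟩
    have hs1 : 1 ≤ - Real.tan (θ τ) := (le_max_right _ _).trans hN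
    have hcm := (cmp _ hs1).1
    have hsp := hspp (- Real.tan (θ τ)) (by linarith)
    have hppp := pp_pos (show 0 < - Real.tan (θ τ) by linarith)
    have hww := ww_pos (show 0 < - Real.tan (θ τ) by linarith)
    have hτC : Φ τ < C := by exact_mod_cast hτ1
    have hP := hΦpos τ
    have hvp := v0 τ
    simp only [Tinv] at hcm ⊢
    set s := - Real.tan (θ τ) with hs
    calc s * pp s * h0 τ = s * pp s * v τ ^ 6 * Φ τ := by simp only [hh0]; ring
      _ ≤ s * pp s * ww s ^ 6 * Φ τ := by gcongr
      _ = Φ τ := by rw [hsp]; ring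
      _ ≤ C := hτC.le⟩
  have hev : ∀ᶠ τ in atBot, ((Φ τ + |W τ| + |Ψ τ| : ℝ) : EReal) ≤ ((20 * K : ℝ) : EReal) := by
    filter_upwards [eventually_le_atBot (T S)] with τ hτ
    rw [EReal.coe_le_coe_iff]
    have hN := hTev _ _ hτ
    have hs1 : 1 ≤ - Real.tan (θ τ) := hS.trans hN
    obtain ⟨c1, c2⟩ := cmp _ hs1
    obtain ⟨b0, b1, b2⟩ := hb _ hN
    have hsp := hspp (- Real.tan (θ τ)) (by linarith)
    have hppp := pp_pos (show 0 < - Real.tan (θ τ) by linarith)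
    have hww := ww_pos (show 0 < - Real.tan (θ τ) by linarith)
    have hP := hΦpos τ
    have hvp := v0 τ
    simp only [Tinv, abs_neg] at c1 c2 b0 b1 b2
    set s := - Real.tan (θ τ) with hs
    have hΦ2 : Φ τ ≤ 2 * K := by
      calc Φ τ = s * pp s * ww s ^ 6 * Φ τ := by rw [hsp]; ring
        _ ≤ s * pp s * (2 * v τ ^ 6) * Φ τ := by gcongr
        _ = 2 * (s * pp s * h0 τ) := by simp only [hh0]; ring
        _ ≤ 2 * K := by linarith
    have hsin : |Real.sin (θ τ)| ≤ 1 := Real.abs_sin_le_one _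
    have hv1 : v τ ≤ 1 := Real.rpow_le_one (hcos τ).le (Real.cos_le_one _) (by norm_num)
    have hq : |Real.sin (θ τ) * v τ ^ 17| ≤ 1 := by
      rw [abs_mul, abs_of_pos (pow_pos hvp 17)]
      exact mul_le_one₀ hsin (by positivity) (pow_le_one₀ hvp.le hv1)
    have hW : W τ = v τ ^ 2 * h1 τ + 2 / 3 * (Real.sin (θ τ) * v τ ^ 17) * Φ τ := by
      simp only [hh1]; field_simp; ring
    have hΨ : Ψ τ = v τ ^ 10 * h2 τ + 4 / 9 * (Real.sin (θ τ) * v τ ^ 17) * W τ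
        - ((16 / 9 * Real.sin (θ τ) ^ 2 - 2 / 3) * v τ ^ 34) * Φ τ := by
      simp only [hh2]; field_simp; ring
    have m1 : |v τ ^ 2 * h1 τ| ≤ K := by
      rw [abs_mul, abs_of_pos (pow_pos hvp 2)]
      refine le_trans ?_ b1
      rw [mul_comm]; gcongr
    have m2 : |v τ ^ 10 * h2 τ| ≤ K := by
      rw [abs_mul, abs_of_pos (pow_pos hvp 10)]
      refine le_trans ?_ b2
      rw [mul_comm]; gcongr
    have hWb : |W τ| ≤ 3 * K := by
      have : |2 / 3 * (Real.sin (θ τ) * v τ ^ 17) * Φ τ| ≤ 2 / 3 * 1 * (2 * K) := by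
        rw [abs_mul, abs_mul, abs_of_pos hP]
        rw [abs_of_pos (show (0:ℝ) < 2 / 3 by norm_num)]
        gcongr
      rw [hW]
      refine (abs_add_le _ _).trans ?_
      linarith
    have hΨb : |Ψ τ| ≤ 10 * K := by
      have n1 : |4 / 9 * (Real.sin (θ τ) * v τ ^ 17) * W τ| ≤ 4 / 9 * 1 * (3 * K) := by
        rw [abs_mul, abs_mul, abs_of_pos (show (0:ℝ) < 4 / 9 by norm_num)]
        gcongr
      have n2 : |((16 / 9 * Real.sin (θ τ) ^ 2 - 2 / 3) * v τ ^ 34) * Φ τ| ≤ 2 * 1 * (2 * K) := by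
        rw [abs_mul, abs_mul, abs_of_pos hP, abs_of_pos (pow_pos hvp 34)]
        have : |16 / 9 * Real.sin (θ τ) ^ 2 - 2 / 3| ≤ 2 := by
          have := Real.sin_sq_le_one (θ τ)
          have := sq_nonneg (Real.sin (θ τ))
          rw [abs_le]; constructor <;> linarith
        have := pow_le_one₀ hvp.le hv1 (n := 34)
        gcongr
      rw [hΨ]
      refine (abs_sub _ _).trans ?_
      have := abs_add_le (v τ ^ 10 * h2 τ) (4 / 9 * (Real.sin (θ τ) * v τ ^ 17) * W τ)
      linarith
    linarith
  have := Filter.limsup_le_of_le (by isBoundedDefault) hev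
  rw [hlimsup] at this
  exact absurd (lt_of_le_of_lt this (EReal.coe_lt_top _)) (lt_irrefl _)

/-- existence of a decreasing sequence of local maximum points with unbounded
values, and of the intermediate sequence of minimum points whose values are eventually
strictly increasing in `n`. -/
theorem minima_eventually_increasing (a : ℝ) (Φ W Ψ θ : ℝ → ℝ)
    (hsol : SolD a Φ W Ψ θ)
    (hΦpos : ∀ τ : ℝ, 0 < Φ τ)
    (hθ : ∀ τ : ℝ, θ τ ∈ Set.Ioo (-(Real.pi / 2)) (Real.pi / 2))
    (hliminf : Filter.liminf (fun τ : ℝ => ((Φ τ : ℝ) : EReal)) atBot < ⊤)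
    (hlimsup : Filter.limsup (fun τ : ℝ => ((Φ τ + |W τ| + |Ψ τ| : ℝ) : EReal)) atBot = ⊤) :
    ∃ τs : ℕ → ℝ, StrictAnti τs ∧ Tendsto τs atTop atBot ∧
      (∀ n : ℕ, IsLocalMax Φ (τs n)) ∧
      Filter.limsup (fun n : ℕ => ((Φ (τs n) : ℝ) : EReal)) atTop = ⊤ ∧
      ∃ τm : ℕ → ℝ, Tendsto τm atTop atBot ∧
        (∀ n : ℕ, 1 ≤ n → τm n ∈ Set.Ioo (τs n) (τs (n - 1)) ∧
          IsMinOn Φ (Set.Icc (τs n) (τs (n - 1))) (τm n) ∧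
          W (τm n) = 0 ∧ 0 ≤ Ψ (τm n)) ∧
        ∃ n₀ : ℕ, ∀ n : ℕ, n₀ < n → Φ (τm (n - 1)) < Φ (τm n) := by
  exact (no_solution a Φ W Ψ θ hsol hΦpos hθ hliminf hlimsup).elim
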